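/- Let f : ℝ² → ℝ be smooth with f(0,0) = 0, f_x(0,0) = 0, f_y(0,0) = 0, and let Σ = {(x,y,z) ∈ ℝ³ : z ≤ f(x,y)}. Suppose z : (0,ε) → ℝ satisfies z(t) → 0 as t → 0⁺ and (G_t * 1_Σ)(0,0,z(t)) = 1/2 for all t ∈ (0,ε). Then, as t → 0⁺, z(t) = t [f_xx + f_yy] + t² [ (1/2)(f_xxxx + 2 f_xxyy + f_yyyy) − (2/3)(f_xx³ + 3 f_xx f_xy² + 3 f_yy f_xy² + f_yy³) ] + O(t³), where all derivatives of f are evaluated at (0,0). -/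

import Mathlib

/-- Partial derivative in the first variable of a function of two real variables. -/
noncomputable def pdx (g : ℝ → ℝ → ℝ) (x y : ℝ) : ℝ := deriv (fun s => g s y) x

/-- Partial derivative in the second variable of a function of two real variables. -/
noncomputable def pdy (g : ℝ → ℝ → ℝ) (x y : ℝ) : ℝ := deriv (fun s => g x s) y

/-- The Gaussian kernel on `ℝ³` at time `t`. -/
noncomputable def G3 (t : ℝ) (p : ℝ × ℝ × ℝ) : ℝ :=
  (4 * Real.pi * t) ^ (-(3 : ℝ) / 2) * Real.exp (-(p.1 ^ 2 + p.2.1 ^ 2 + p.2.2 ^ 2) / (4 * t))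

/-- Convolution of the Gaussian kernel on `ℝ³` with a function. -/
noncomputable def conv3 (t : ℝ) (u : ℝ × ℝ × ℝ → ℝ) (p : ℝ × ℝ × ℝ) : ℝ :=
  ∫ q : ℝ × ℝ × ℝ, G3 t (p.1 - q.1, p.2.1 - q.2.1, p.2.2 - q.2.2) * u q
open MeasureTheory ProbabilityTheory Set

noncomputable abbrev mboG : ℝ → ℝ := gaussianPDFReal 0 2
noncomputable abbrev mboγ : Measure ℝ := gaussianReal 0 2

theorem mboG_eq (x : ℝ) : mboG x = (√(4 * Real.pi))⁻¹ * Real.exp (-x ^ 2 / 4) := by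
  simp only [mboG, gaussianPDFReal]
  push_cast
  congr 3 <;> ring_nf

theorem mboG_cont : Continuous mboG := by
  rw [show mboG = fun x => (√(4 * Real.pi))⁻¹ * Real.exp (-x ^ 2 / 4) from funext mboG_eq]
  fun_prop

theorem mboG_int : Integrable mboG := integrable_gaussianPDFReal 0 2

theorem mboG_nonneg (x : ℝ) : 0 ≤ mboG x := gaussianPDFReal_nonneg 0 2 x

theorem mbo_pow_int (n : ℕ) : Integrable (fun x : ℝ => x ^ n) mboγ := by
  have h := (memLp_id_gaussianReal (μ := 0) (v := 2) (n : NNReal)).integrable_norm_pow'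
  have := (integrable_norm_iff (f := fun x : ℝ => x ^ n) (μ := mboγ) (by fun_prop)).1
  apply this
  simpa using h

theorem mbo_absPow_int (n : ℕ) : Integrable (fun x : ℝ => |x| ^ n) mboγ := by
  simpa using (mbo_pow_int n).norm

theorem mbo_pow_int' (n : ℕ) : Integrable (fun x : ℝ => x ^ n * mboG x) := by
  have h := mbo_pow_int n
  rw [mboγ, gaussianReal_of_var_ne_zero 0 (by norm_num : (2 : NNReal) ≠ 0),
    integrable_withDensity_iff_integrable_smul' (measurable_gaussianPDF 0 2)
    (by simp [gaussianPDF])] at h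
  simpa [mul_comm] using h

theorem mbo_mom_eq (n : ℕ) : ∫ x, x ^ n ∂mboγ = ∫ x, x ^ n * mboG x := by
  rw [mboγ, integral_gaussianReal_eq_integral_smul (by norm_num)]
  simp [mul_comm]

theorem mboG_deriv (x : ℝ) : HasDerivAt mboG (-(x / 2) * mboG x) x := by
  rw [show mboG = fun x => (√(4 * Real.pi))⁻¹ * Real.exp (-x ^ 2 / 4) from funext mboG_eq]
  have h : HasDerivAt (fun x : ℝ => -x ^ 2 / 4) (-(x / 2)) x := by
    have := ((hasDerivAt_pow 2 x).neg).div_const 4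
    refine this.congr_deriv ?_
    norm_num; ring
  refine ((h.exp).const_mul ((√(4 * Real.pi))⁻¹)).congr_deriv ?_
  ring

theorem mbo_mom_rec (n : ℕ) :
    ∫ x, x ^ (n + 2) ∂mboγ = 2 * (n + 1) * ∫ x, x ^ n ∂mboγ := by
  have h := integral_mul_deriv_eq_deriv_mul_of_integrable
    (u := fun x : ℝ => x ^ (n + 1)) (u' := fun x => ((n + 1 : ℕ) : ℝ) * x ^ n)
    (v := mboG) (v' := fun x => -(x / 2) * mboG x)
    (fun x _ => by simpa using hasDerivAt_pow (n + 1) x) (fun x _ => mboG_deriv x)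
    (by
      have := (mbo_pow_int' (n + 2)).const_mul (-(1 / 2))
      refine this.congr (Filter.Eventually.of_forall fun x => ?_)
      simp; ring)
    (by
      have := (mbo_pow_int' n).const_mul ((n + 1 : ℕ) : ℝ)
      refine this.congr (Filter.Eventually.of_forall fun x => ?_)
      simp; ring)
    (mbo_pow_int' (n + 1))
  rw [mbo_mom_eq, mbo_mom_eq]
  have e1 : ∫ x, x ^ (n + 1) * (-(x / 2) * mboG x) = -(1 / 2) * ∫ x, x ^ (n + 2) * mboG x := by
    rw [← integral_const_mul]; congr 1; ext x; ring
  have e2 : ∫ x, ((n + 1 : ℕ) : ℝ) * x ^ n * mboG x = (n + 1) * ∫ x, x ^ n * mboG x := by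
    rw [← integral_const_mul]; congr 1; ext x; push_cast; ring
  rw [e1, e2] at h
  linarith

theorem mbo_m0 : ∫ x, x ^ 0 ∂mboγ = 1 := by simp
theorem mbo_m1 : ∫ x, x ^ 1 ∂mboγ = 0 := by simp [mboγ, integral_id_gaussianReal]
theorem mbo_m2 : ∫ x, x ^ 2 ∂mboγ = 2 := by
  have := mbo_mom_rec 0; rw [mbo_m0] at this; norm_num at this; exact this
theorem mbo_m3 : ∫ x, x ^ 3 ∂mboγ = 0 := by
  have := mbo_mom_rec 1; rw [mbo_m1] at this; norm_num at this; exact this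
theorem mbo_m4 : ∫ x, x ^ 4 ∂mboγ = 12 := by
  have := mbo_mom_rec 2; rw [mbo_m2] at this; norm_num at this; exact this
theorem mbo_m5 : ∫ x, x ^ 5 ∂mboγ = 0 := by
  have := mbo_mom_rec 3; rw [mbo_m3] at this; norm_num at this; exact this
theorem mbo_m6 : ∫ x, x ^ 6 ∂mboγ = 120 := by
  have := mbo_mom_rec 4; rw [mbo_m4] at this; norm_num at this; exact this

noncomputable def mboΨ (a : ℝ) : ℝ := ∫ s in (0 : ℝ)..a, mboG s

theorem mboΨ_sub (a b : ℝ) : mboΨ a - mboΨ b = ∫ s in b..a, mboG s := by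
  unfold mboΨ
  rw [intervalIntegral.integral_interval_sub_left] <;> exact mboG_cont.intervalIntegrable _ _

theorem mboG_even (x : ℝ) : mboG (-x) = mboG x := by simp [mboG_eq]

theorem mboG_half : ∫ x in Iic (0 : ℝ), mboG x = 1 / 2 := by
  have h1 := integral_comp_neg_Iic (0 : ℝ) mboG
  simp only [mboG_even, neg_zero] at h1
  have h2 := intervalIntegral.integral_Iic_add_Ioi (b := (0 : ℝ)) mboG_int.integrableOn
    mboG_int.integrableOn
  rw [integral_gaussianPDFReal_eq_one 0 (by norm_num)] at h2
  linarith

theorem mboΨ_cdf (a : ℝ) : ∫ x in Iic a, mboG x = 1 / 2 + mboΨ a := by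
  have := intervalIntegral.integral_Iic_sub_Iic (f := mboG) (a := 0) (b := a) (μ := volume)
    mboG_int.integrableOn mboG_int.integrableOn
  rw [mboG_half] at this
  unfold mboΨ
  linarith

theorem mboΨ_bd (a : ℝ) : |mboΨ a| ≤ 1 / 2 := by
  have h := mboΨ_cdf a
  have h1 : 0 ≤ ∫ x in Iic a, mboG x := setIntegral_nonneg measurableSet_Iic fun x _ => mboG_nonneg x
  have h2 : ∫ x in Iic a, mboG x ≤ ∫ x, mboG x :=
    setIntegral_le_integral mboG_int (Filter.Eventually.of_forall mboG_nonneg)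
  rw [integral_gaussianPDFReal_eq_one 0 (by norm_num)] at h2
  rw [abs_le]; constructor <;> linarith

noncomputable def mboc : ℝ := (√(4 * Real.pi))⁻¹
theorem mboc_pos : 0 < mboc := by unfold mboc; positivity
theorem mboc_le : mboc ≤ 1 := by
  unfold mboc
  apply inv_le_one_of_one_le₀
  rw [Real.one_le_sqrt]
  linarith [Real.pi_gt_three]

theorem mboG_le (x : ℝ) : mboG x ≤ 1 := by
  rw [mboG_eq]
  have : Real.exp (-x ^ 2 / 4) ≤ 1 := by rw [Real.exp_le_one_iff]; nlinarith [sq_nonneg x]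
  have h := mboc_le
  have h' := mboc_pos
  unfold mboc at h h'
  nlinarith [Real.exp_pos (-x ^ 2 / 4)]

theorem mboΨ_lip (a b : ℝ) : |mboΨ a - mboΨ b| ≤ |a - b| := by
  rw [mboΨ_sub]
  have := intervalIntegral.norm_integral_le_of_norm_le_const (f := mboG) (a := b) (b := a) (C := 1)
    (fun x _ => by rw [Real.norm_eq_abs, abs_of_nonneg (mboG_nonneg x)]; exact mboG_le x)
  simpa using this

theorem mboΨ_cont : Continuous mboΨ := by
  have : LipschitzWith 1 mboΨ := LipschitzWith.of_dist_le_mul fun a b => by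
    simpa [Real.dist_eq] using mboΨ_lip a b
  exact this.continuous

theorem mboΨ_neg (a : ℝ) : mboΨ (-a) = - mboΨ a := by
  unfold mboΨ
  have := intervalIntegral.integral_comp_neg (a := 0) (b := a) mboG
  simp only [mboG_even, neg_zero] at this
  rw [this, intervalIntegral.integral_symm]

theorem mboΨ_mono : Monotone mboΨ := by
  intro a b h
  have := mboΨ_sub b a
  have h2 := intervalIntegral.integral_nonneg (f := mboG) (μ := volume) h fun x _ => mboG_nonneg x
  linarith

theorem mboΨ_lower0 (a : ℝ) (h0 : 0 ≤ a) (h1 : a ≤ 1) : mboG 1 * a ≤ mboΨ a := by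
  unfold mboΨ
  have := intervalIntegral.integral_mono_on (f := fun _ => mboG 1) (g := mboG) (μ := volume) h0
    (by simp) (mboG_cont.intervalIntegrable _ _) (fun x hx => by
      rw [mboG_eq, mboG_eq]
      gcongr
      exact hx.1
      exact hx.2.trans h1)
  simpa [mul_comm] using this

theorem mboΨ_lower (a : ℝ) : mboG 1 * min |a| 1 ≤ |mboΨ a| := by
  have key : ∀ a : ℝ, 0 ≤ a → mboG 1 * min a 1 ≤ mboΨ a := fun a ha =>
    (mboΨ_lower0 (min a 1) (by positivity) (min_le_right _ _)).trans (mboΨ_mono (min_le_left _ _))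
  rcases le_total 0 a with h | h
  · rw [abs_of_nonneg h]
    exact (key a h).trans (le_abs_self _)
  · rw [abs_of_nonpos h]
    refine (key (-a) (by linarith)).trans ?_
    rw [mboΨ_neg]
    exact neg_le_abs _

theorem mbo_exp_bd (s : ℝ) (hs : 0 ≤ s) : |Real.exp (-s) - (1 - s)| ≤ s ^ 2 := by
  rcases le_total s 1 with h | h
  · have := Real.abs_exp_sub_one_sub_id_le (x := -s) (by rw [abs_neg, abs_of_nonneg hs]; exact h)
    convert this using 1
    · congr 1; ring
    · ring
  · have h1 := Real.exp_pos (-s)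
    have h2 : Real.exp (-s) ≤ 1 := by rw [Real.exp_le_one_iff]; linarith
    rw [abs_le]; constructor <;> nlinarith

theorem mboΨ_taylor (a : ℝ) : |mboΨ a - mboc * (a - a ^ 3 / 12)| ≤ |a| ^ 5 := by
  have e : mboΨ a - mboc * (a - a ^ 3 / 12) =
      ∫ s in (0 : ℝ)..a, (mboG s - mboc * (1 - s ^ 2 / 4)) := by
    rw [intervalIntegral.integral_sub (mboG_cont.intervalIntegrable _ _)
      (Continuous.intervalIntegrable (by fun_prop) _ _), intervalIntegral.integral_const_mul,
      intervalIntegral.integral_sub (by simp) (Continuous.intervalIntegrable (by fun_prop) _ _)]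
    simp only [intervalIntegral.integral_div, integral_pow]
    simp only [mboΨ, intervalIntegral.integral_const, smul_eq_mul]
    push_cast
    ring
  rw [e]
  have := intervalIntegral.norm_integral_le_of_norm_le_const
    (f := fun s => mboG s - mboc * (1 - s ^ 2 / 4)) (a := 0) (b := a) (C := |a| ^ 4)
    (fun x hx => by
      have hx' : |x| ≤ |a| := by
        rcases le_total 0 a with h | h
        · rw [uIoc_of_le h] at hx; rw [abs_of_pos hx.1, abs_of_nonneg h]; exact hx.2
        · rw [uIoc_of_ge h] at hx; rw [abs_of_nonpos hx.2, abs_of_nonpos h]; linarith [hx.1]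
      rw [mboG_eq]
      change ‖mboc * _ - _‖ ≤ _
      rw [← mul_sub, Real.norm_eq_abs, abs_mul, abs_of_pos mboc_pos]
      have h1 := mbo_exp_bd (x ^ 2 / 4) (by positivity)
      rw [← neg_div] at h1
      have h2 : |x| ^ 4 ≤ |a| ^ 4 := by gcongr
      have h3 : (x ^ 2 / 4) ^ 2 ≤ |x| ^ 4 := by
        rw [show |x| ^ 4 = x ^ 4 by rw [show |x|^4 = (|x|^2)^2 by ring, sq_abs]; ring]
        nlinarith [sq_nonneg (x^2)]
      have h4 := mboc_le
      have h5 := mboc_pos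
      nlinarith [abs_nonneg (Real.exp (-x ^ 2 / 4) - (1 - x ^ 2 / 4))])
  rw [Real.norm_eq_abs] at this
  refine this.trans (le_of_eq ?_)
  simp; ring

open MeasureTheory ProbabilityTheory Set

theorem mbo_taylor1 (C : ℝ) : ∀ (n : ℕ) (g : ℕ → ℝ → ℝ)
    (_hg : ∀ j s, HasDerivAt (g j) (g (j + 1) s) s)
    (_hC : ∀ s, |s| ≤ 1 → |g n s| ≤ C), ∀ s, |s| ≤ 1 →
    |g 0 s - ∑ j ∈ Finset.range n, g j 0 * s ^ j / (j.factorial : ℝ)| ≤ C * |s| ^ n := by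
  intro n
  induction n with
  | zero => intro g _ hC s hs; simpa using hC s hs
  | succ n ih =>
    intro g hg hC s hs
    have ih' := ih (fun j => g (j + 1)) (fun j s => hg (j + 1) s) hC
    set h : ℝ → ℝ := fun s => g 0 s - ∑ j ∈ Finset.range (n + 1), g j 0 * s ^ j / (j.factorial : ℝ)
      with hh
    have hd : ∀ x, HasDerivAt h
        (g 1 x - ∑ j ∈ Finset.range n, g (j + 1) 0 * x ^ j / (j.factorial : ℝ)) x := by
      intro x
      rw [hh]
      refine (hg 0 x).sub ?_
      have h1 : HasDerivAt (fun s : ℝ => ∑ j ∈ Finset.range (n + 1), g j 0 * s ^ j / (j.factorial : ℝ))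
          (∑ j ∈ Finset.range (n + 1), g j 0 * ((j : ℝ) * x ^ (j - 1)) / (j.factorial : ℝ)) x := by
        apply HasDerivAt.fun_sum
        intro j _
        exact ((hasDerivAt_pow j x).const_mul _).div_const _
      refine h1.congr_deriv ?_
      rw [Finset.sum_range_succ']
      simp only [Nat.cast_zero, zero_mul, mul_zero, zero_div, add_zero, Nat.add_sub_cancel]
      apply Finset.sum_congr rfl
      intro j _
      rw [Nat.factorial_succ]
      push_cast
      have : (j.factorial : ℝ) ≠ 0 := by positivity
      have : (j : ℝ) + 1 ≠ 0 := by positivity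
      field_simp
    have h0 : h 0 = 0 := by
      simp [hh, Finset.sum_range_succ']
    have hm := (convex_Icc (-|s|) |s|).norm_image_sub_le_of_norm_hasDerivWithin_le (f := h)
      (C := C * |s| ^ n) (x := 0) (y := s) (fun x _ => (hd x).hasDerivWithinAt)
      (fun x hx => by
        have hx' : |x| ≤ |s| := abs_le.2 hx
        refine (ih' x (hx'.trans hs)).trans ?_
        have hC0 : 0 ≤ C := (abs_nonneg _).trans (hC 0 (by simp))
        gcongr)
      (by simp) (by simp [neg_abs_le, le_abs_self])
    rw [h0] at hm
    simp only [sub_zero, Real.norm_eq_abs] at hm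
    refine hm.trans (le_of_eq ?_)
    ring

abbrev mboSm (g : ℝ → ℝ → ℝ) : Prop := ContDiff ℝ (⊤ : ℕ∞) (fun p : ℝ × ℝ => g p.1 p.2)

theorem mboSm_hasy {g : ℝ → ℝ → ℝ} (hg : mboSm g) (x y : ℝ) :
    HasDerivAt (fun s => g x s) (fderiv ℝ (fun p : ℝ × ℝ => g p.1 p.2) (x, y) (0, 1)) y := by
  have h1 : HasFDerivAt (fun p : ℝ × ℝ => g p.1 p.2) _ (x, y) :=
    (hg.differentiable (by simp) (x, y)).hasFDerivAt
  exact h1.comp_hasDerivAt (f := fun s : ℝ => (x, s)) y ((hasDerivAt_const y x).prodMk (hasDerivAt_id y))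

theorem mboSm_hasx {g : ℝ → ℝ → ℝ} (hg : mboSm g) (x y : ℝ) :
    HasDerivAt (fun s => g s y) (fderiv ℝ (fun p : ℝ × ℝ => g p.1 p.2) (x, y) (1, 0)) x := by
  have h1 : HasFDerivAt (fun p : ℝ × ℝ => g p.1 p.2) _ (x, y) :=
    (hg.differentiable (by simp) (x, y)).hasFDerivAt
  exact h1.comp_hasDerivAt (f := fun s : ℝ => (s, y)) x ((hasDerivAt_id x).prodMk (hasDerivAt_const x y))

theorem mboSm_pdy {g : ℝ → ℝ → ℝ} (hg : mboSm g) : mboSm (pdy g) := by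
  have : (fun p : ℝ × ℝ => pdy g p.1 p.2) =
      fun p => fderiv ℝ (fun p : ℝ × ℝ => g p.1 p.2) p (0, 1) := by
    ext p; exact (mboSm_hasy hg p.1 p.2).deriv
  unfold mboSm
  rw [this]
  exact (hg.fderiv_right (m := (⊤ : ℕ∞)) (by simp)).clm_apply contDiff_const

theorem mboSm_pdx {g : ℝ → ℝ → ℝ} (hg : mboSm g) : mboSm (pdx g) := by
  have : (fun p : ℝ × ℝ => pdx g p.1 p.2) =
      fun p => fderiv ℝ (fun p : ℝ × ℝ => g p.1 p.2) p (1, 0) := by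
    ext p; exact (mboSm_hasx hg p.1 p.2).deriv
  unfold mboSm
  rw [this]
  exact (hg.fderiv_right (m := (⊤ : ℕ∞)) (by simp)).clm_apply contDiff_const

theorem mboSm_y {g : ℝ → ℝ → ℝ} (hg : mboSm g) (x y : ℝ) :
    HasDerivAt (fun s => g x s) (pdy g x y) y :=
  (mboSm_hasy hg x y).differentiableAt.hasDerivAt

theorem mboSm_x {g : ℝ → ℝ → ℝ} (hg : mboSm g) (x y : ℝ) :
    HasDerivAt (fun s => g s y) (pdx g x y) x :=
  (mboSm_hasx hg x y).differentiableAt.hasDerivAt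

noncomputable def mboD (f : ℝ → ℝ → ℝ) (i j : ℕ) : ℝ → ℝ → ℝ := pdx^[i] (pdy^[j] f)

theorem mboD_sm {f : ℝ → ℝ → ℝ} (hf : mboSm f) (i j : ℕ) : mboSm (mboD f i j) := by
  unfold mboD
  have h : ∀ j, mboSm (pdy^[j] f) := by
    intro j
    induction j with
    | zero => exact hf
    | succ j ih => rw [Function.iterate_succ_apply']; exact mboSm_pdy ih
  induction i with
  | zero => exact h j
  | succ j ih => rw [Function.iterate_succ_apply']; exact mboSm_pdx ih

theorem mboSm_bdd {g : ℝ → ℝ → ℝ} (hg : mboSm g) :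
    ∃ C, 0 ≤ C ∧ ∀ x y, |x| ≤ 1 → |y| ≤ 1 → |g x y| ≤ C := by
  have hc : IsCompact (Icc (-1 : ℝ) 1 ×ˢ Icc (-1 : ℝ) 1) := isCompact_Icc.prod isCompact_Icc
  obtain ⟨C, hC⟩ := hc.exists_bound_of_continuousOn hg.continuous.continuousOn
  refine ⟨C, (norm_nonneg _).trans (hC (0, 0) (by simp)), fun x y hx hy => ?_⟩
  exact hC (x, y) ⟨abs_le.1 hx, abs_le.1 hy⟩

theorem mbo_taylor2 {f : ℝ → ℝ → ℝ} (hf : mboSm f) :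
    ∃ C, 0 ≤ C ∧ ∀ x y, |x| ≤ 1 → |y| ≤ 1 →
      |f x y - ∑ j ∈ Finset.range 6, (∑ i ∈ Finset.range (6 - j),
        mboD f i j 0 0 * x ^ i / (i.factorial : ℝ)) * y ^ j / (j.factorial : ℝ)|
        ≤ C * (|x| + |y|) ^ 6 := by
  choose B hB0 hB using fun i j => mboSm_bdd (mboD_sm hf i j)
  refine ⟨B 0 6 + ∑ j ∈ Finset.range 6, B (6 - j) j, ?_, ?_⟩
  · exact add_nonneg (hB0 _ _) (Finset.sum_nonneg fun j _ => hB0 _ _)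
  intro x y hx hy
  have h1 := mbo_taylor1 (B 0 6) 6 (fun j s => mboD f 0 j x s)
    (fun j s => by
      have := mboSm_y (mboD_sm hf 0 j) x s
      simpa [mboD, Function.iterate_succ_apply'] using this)
    (fun s hs => hB 0 6 x s hx hs) y hy
  have h2 : ∀ j, |mboD f 0 j x 0 - ∑ i ∈ Finset.range (6 - j),
        mboD f i j 0 0 * x ^ i / (i.factorial : ℝ)| ≤ B (6 - j) j * |x| ^ (6 - j) := fun j =>
    mbo_taylor1 (B (6 - j) j) (6 - j) (fun i s => mboD f i j s 0)
    (fun i s => by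
      have := mboSm_x (mboD_sm hf i j) s 0
      simpa [mboD, Function.iterate_succ_apply'] using this)
    (fun s hs => hB _ _ s 0 hs (by simp)) x hx
  have e : f x y - ∑ j ∈ Finset.range 6, (∑ i ∈ Finset.range (6 - j),
        mboD f i j 0 0 * x ^ i / (i.factorial : ℝ)) * y ^ j / (j.factorial : ℝ)
      = (mboD f 0 0 x y - ∑ j ∈ Finset.range 6, mboD f 0 j x 0 * y ^ j / (j.factorial : ℝ))
        + ∑ j ∈ Finset.range 6, (mboD f 0 j x 0 - ∑ i ∈ Finset.range (6 - j),
        mboD f i j 0 0 * x ^ i / (i.factorial : ℝ)) * y ^ j / (j.factorial : ℝ) := by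
    have : mboD f 0 0 x y = f x y := rfl
    simp only [sub_mul, sub_div, Finset.sum_sub_distrib, this]
    ring
  rw [e, add_mul, Finset.sum_mul]
  refine (abs_add_le _ _).trans (add_le_add ?_ ?_)
  · refine h1.trans ?_
    have := hB0 0 6
    gcongr
    linarith [abs_nonneg x]
  · refine (Finset.abs_sum_le_sum_abs _ _).trans (Finset.sum_le_sum fun j hj => ?_)
    have hj6 : j < 6 := Finset.mem_range.1 hj
    rw [abs_div, abs_mul, abs_pow]
    have hfac : (1 : ℝ) ≤ |(j.factorial : ℝ)| := by
      rw [Nat.abs_cast]; exact_mod_cast Nat.factorial_pos j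
    refine (div_le_self (by positivity) hfac).trans ?_
    calc _ ≤ B (6 - j) j * |x| ^ (6 - j) * |y| ^ j := by gcongr; exact h2 j
      _ ≤ B (6 - j) j * (|x| + |y|) ^ (6 - j) * (|x| + |y|) ^ j := by
        have := hB0 (6 - j) j
        gcongr
        · linarith [abs_nonneg y]
        · linarith [abs_nonneg x]
      _ = _ := by rw [mul_assoc, ← pow_add]; congr 2; omega

open MeasureTheory ProbabilityTheory Set

theorem mbo_G3 (h : ℝ) (hh : 0 < h) (a b c : ℝ) :
    G3 (h ^ 2) (a, b, c) = (h⁻¹ * mboG (h⁻¹ * a)) * ((h⁻¹ * mboG (h⁻¹ * b)) * (h⁻¹ * mboG (h⁻¹ * c))) := by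
  simp only [G3, mboG_eq]
  have hp : (0 : ℝ) < √(4 * Real.pi) := by positivity
  have e1 : (4 * Real.pi * h ^ 2) ^ (-(3 : ℝ) / 2) = (√(4 * Real.pi))⁻¹ ^ 3 * h⁻¹ ^ 3 := by
    have : 4 * Real.pi * h ^ 2 = (√(4 * Real.pi) * h) ^ (2 : ℝ) := by
      rw [Real.rpow_two, mul_pow, Real.sq_sqrt (by positivity)]
    rw [this, ← Real.rpow_mul (by positivity), ← mul_pow, ← mul_inv, inv_pow]
    rw [show (2 : ℝ) * (-3 / 2) = -((3 : ℕ) : ℝ) by norm_num, Real.rpow_neg (by positivity),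
      Real.rpow_natCast]
  have e2 : Real.exp (-(a ^ 2 + b ^ 2 + c ^ 2) / (4 * h ^ 2)) =
      Real.exp (-(h⁻¹ * a) ^ 2 / 4) * Real.exp (-(h⁻¹ * b) ^ 2 / 4) * Real.exp (-(h⁻¹ * c) ^ 2 / 4) := by
    rw [← Real.exp_add, ← Real.exp_add]
    congr 1
    field_simp
    ring
  rw [e1, e2]
  ring

theorem mbo_scale (h : ℝ) (hh : 0 < h) (F : ℝ → ℝ) :
    ∫ x, (h⁻¹ * mboG (h⁻¹ * x)) * F x = ∫ x, F (h * x) ∂mboγ := by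
  rw [mboγ, integral_gaussianReal_eq_integral_smul (by norm_num)]
  have := Measure.integral_comp_mul_left (fun x => mboG x * F (h * x)) h⁻¹
  simp only [inv_inv, abs_of_pos hh, smul_eq_mul] at this
  simp only [smul_eq_mul]
  rw [← mul_right_inj' hh.ne', ← this, ← integral_const_mul]
  congr 1; ext x
  field_simp

theorem mbo_inner (h : ℝ) (hh : 0 < h) (z a : ℝ) :
    ∫ w, (h⁻¹ * mboG (h⁻¹ * (z - w))) * (Iic a).indicator 1 w = 1 / 2 + mboΨ ((a - z) / h) := by
  have e0 : ∫ w, (h⁻¹ * mboG (h⁻¹ * (z - w))) * (Iic a).indicator 1 w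
      = ∫ w, (h⁻¹ * mboG (h⁻¹ * w)) * (Iic (a - z)).indicator 1 w := by
    rw [← integral_sub_right_eq_self
      (fun w => (h⁻¹ * mboG (h⁻¹ * w)) * (Iic (a - z)).indicator (1 : ℝ → ℝ) w) z]
    congr 1; ext w
    rw [← mboG_even, show -(h⁻¹ * (z - w)) = h⁻¹ * (w - z) by ring]
    simp [indicator]
  rw [e0, mbo_scale h hh, mboγ, integral_gaussianReal_eq_integral_smul (by norm_num), ← mboΨ_cdf,
    ← integral_indicator measurableSet_Iic]
  congr 1; ext w
  simp only [indicator, mem_Iic, le_div_iff₀ hh, mul_comm h w]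
  split_ifs <;> simp

theorem mbo_conv (f : ℝ → ℝ → ℝ) (hf : Continuous (fun p : ℝ × ℝ => f p.1 p.2)) (h : ℝ) (hh : 0 < h)
    (z : ℝ) :
    conv3 (h ^ 2) (Set.indicator {p : ℝ × ℝ × ℝ | p.2.2 ≤ f p.1 p.2.1} 1) (0, 0, z)
      = 1 / 2 + ∫ p : ℝ × ℝ, mboΨ ((f (h * p.1) (h * p.2) - z) / h) ∂(mboγ.prod mboγ) := by
  unfold conv3
  simp only [mbo_G3 h hh]
  set k : ℝ → ℝ := fun x => h⁻¹ * mboG (h⁻¹ * x) with hk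
  have hki : Integrable k := by
    rw [hk]
    exact (mboG_int.comp_mul_left' (by positivity)).const_mul _
  have hk1 : Integrable (fun x => k (0 - x)) := hki.comp_sub_left 0
  have hkz : Integrable (fun x => k (z - x)) := hki.comp_sub_left z
  set S : Set (ℝ × ℝ × ℝ) := {p | p.2.2 ≤ f p.1 p.2.1} with hS
  have hSm : MeasurableSet S := by
    have : IsClosed S := by
      rw [hS]
      apply isClosed_le (by fun_prop)
      exact hf.comp (continuous_fst.prodMk (continuous_fst.comp continuous_snd))
    exact this.measurableSet
  have hI0 : Integrable (fun q : ℝ × ℝ × ℝ => k (0 - q.1) * (k (0 - q.2.1) * k (z - q.2.2))) :=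
    hk1.mul_prod (hk1.mul_prod hkz)
  have hI : Integrable (fun q : ℝ × ℝ × ℝ =>
      k (0 - q.1) * (k (0 - q.2.1) * k (z - q.2.2)) * S.indicator 1 q) := by
    refine (hI0.indicator hSm).congr (Filter.Eventually.of_forall fun q => ?_)
    by_cases hq : q ∈ S <;> simp [hq]
  have keven : ∀ x, k (0 - x) = k x := by
    intro x; simp only [hk]; rw [← mboG_even]; congr 2; ring
  have step1 : (∫ q : ℝ × ℝ × ℝ, k (0 - q.1) * (k (0 - q.2.1) * k (z - q.2.2)) * S.indicator 1 q)
      = ∫ x, ∫ y, ∫ w, k x * (k y * (k (z - w) * (Iic (f x y)).indicator 1 w)) := by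
    rw [Measure.volume_eq_prod, integral_prod _ hI]
    have hae := hI.prod_right_ae
    apply integral_congr_ae
    filter_upwards [hae] with x hx
    rw [Measure.volume_eq_prod, integral_prod _ hx]
    congr 1; ext y; congr 1; ext w
    rw [keven, keven]
    have : S.indicator (1 : ℝ × ℝ × ℝ → ℝ) (x, y, w) = (Iic (f x y)).indicator 1 w := by
      simp [indicator, hS]
    rw [this]; ring
  rw [step1]
  simp only [integral_const_mul]
  have step2 : ∀ x y, ∫ w, k (z - w) * (Iic (f x y)).indicator 1 w
      = 1 / 2 + mboΨ ((f x y - z) / h) := fun x y => mbo_inner h hh z (f x y)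
  simp only [step2]
  simp only [hk, mbo_scale h hh]
  have hcont : Continuous (fun p : ℝ × ℝ => mboΨ ((f (h * p.1) (h * p.2) - z) / h)) := by
    apply mboΨ_cont.comp
    have : Continuous (fun p : ℝ × ℝ => f (h * p.1) (h * p.2)) :=
      hf.comp (f := fun p : ℝ × ℝ => (h * p.1, h * p.2)) (by fun_prop)
    fun_prop
  have hIntg : Integrable (fun p : ℝ × ℝ => mboΨ ((f (h * p.1) (h * p.2) - z) / h))
      (mboγ.prod mboγ) :=
    Integrable.of_bound hcont.aestronglyMeasurable (1 / 2)
      (Filter.Eventually.of_forall fun p => mboΨ_bd _)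
  have hint2 : Integrable (fun p : ℝ × ℝ => 1 / 2 + mboΨ ((f (h * p.1) (h * p.2) - z) / h))
      (mboγ.prod mboγ) := (integrable_const _).add hIntg
  rw [← integral_prod (fun p : ℝ × ℝ => 1 / 2 + mboΨ ((f (h * p.1) (h * p.2) - z) / h)) hint2,
    integral_add (integrable_const _) hIntg]
  simp

open MeasureTheory ProbabilityTheory Set

noncomputable abbrev mboP : Measure (ℝ × ℝ) := mboγ.prod mboγ

def mboW (p : ℝ × ℝ) : ℝ := 1 + |p.1| + |p.2|

theorem mboW_cont : Continuous mboW := by unfold mboW; fun_prop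
theorem mboW_ge (p : ℝ × ℝ) : 1 ≤ mboW p := by
  unfold mboW; linarith [abs_nonneg p.1, abs_nonneg p.2]
theorem mboW_x (p : ℝ × ℝ) : |p.1| ≤ mboW p := by
  unfold mboW; linarith [abs_nonneg p.1, abs_nonneg p.2]
theorem mboW_y (p : ℝ × ℝ) : |p.2| ≤ mboW p := by
  unfold mboW; linarith [abs_nonneg p.1, abs_nonneg p.2]

theorem mboW_int (n : ℕ) : Integrable (fun p => mboW p ^ n) mboP := by
  have h : Integrable (fun p : ℝ × ℝ => 3 ^ n * (1 + |p.1| ^ n + |p.2| ^ n)) mboP := by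
    apply Integrable.const_mul
    apply Integrable.add
    · exact (integrable_const _).add ((mbo_absPow_int n).comp_fst _)
    · exact (mbo_absPow_int n).comp_snd _
  refine h.mono' (mboW_cont.pow n).aestronglyMeasurable (Filter.Eventually.of_forall fun p => ?_)
  have h0 : 0 ≤ mboW p := zero_le_one.trans (mboW_ge p)
  rw [Real.norm_eq_abs, abs_of_nonneg (by positivity)]
  have hm : mboW p ≤ 3 * max 1 (max |p.1| |p.2|) := by
    have h1 : 1 ≤ max 1 (max |p.1| |p.2|) := le_max_left _ _
    have h2 : |p.1| ≤ max 1 (max |p.1| |p.2|) := (le_max_left _ _).trans (le_max_right _ _)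
    have h3 : |p.2| ≤ max 1 (max |p.1| |p.2|) := (le_max_right _ _).trans (le_max_right _ _)
    unfold mboW; linarith
  calc mboW p ^ n ≤ (3 * max 1 (max |p.1| |p.2|)) ^ n := by gcongr
    _ = 3 ^ n * (max 1 (max |p.1| |p.2|)) ^ n := mul_pow _ _ _
    _ ≤ _ := by
      gcongr
      have hx : 0 ≤ |p.1| ^ n := by positivity
      have hy : 0 ≤ |p.2| ^ n := by positivity
      rcases max_choice 1 (max |p.1| |p.2|) with h | h <;> rw [h]
      · simp; linarith
      · rcases max_choice |p.1| |p.2| with h | h <;> rw [h] <;> linarith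

noncomputable def mboM (n : ℕ) : ℝ := ∫ p, mboW p ^ n ∂mboP

theorem mboM_nonneg (n : ℕ) : 0 ≤ mboM n :=
  integral_nonneg fun p => pow_nonneg (zero_le_one.trans (mboW_ge p)) n

theorem mbo_intble {F : ℝ × ℝ → ℝ} (hF : Continuous F) (K : ℝ) (n : ℕ)
    (hb : ∀ p, |F p| ≤ K * mboW p ^ n) : Integrable F mboP :=
  ((mboW_int n).const_mul K).mono' hF.aestronglyMeasurable (Filter.Eventually.of_forall hb)

theorem mbo_bound {F : ℝ × ℝ → ℝ} (K : ℝ) (n : ℕ)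
    (hb : ∀ p, |F p| ≤ K * mboW p ^ n) : |∫ p, F p ∂mboP| ≤ K * mboM n := by
  have := norm_integral_le_of_norm_le (f := F) ((mboW_int n).const_mul K) (Filter.Eventually.of_forall hb)
  rwa [integral_const_mul] at this

def mboHI (F : ℝ × ℝ → ℝ) (v : ℝ) : Prop := Integrable F mboP ∧ ∫ p, F p ∂mboP = v

theorem mboHI.add {F G : ℝ × ℝ → ℝ} {v w : ℝ} (h : mboHI F v) (h' : mboHI G w) :
    mboHI (fun p => F p + G p) (v + w) :=
  ⟨h.1.add h'.1, by rw [integral_add h.1 h'.1, h.2, h'.2]⟩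

theorem mboHI.cmul {F : ℝ × ℝ → ℝ} {v : ℝ} (c : ℝ) (h : mboHI F v) :
    mboHI (fun p => c * F p) (c * v) :=
  ⟨h.1.const_mul c, by rw [integral_const_mul, h.2]⟩

theorem mboHI_mono (i j : ℕ) : mboHI (fun p => p.1 ^ i * p.2 ^ j)
    ((∫ x, x ^ i ∂mboγ) * ∫ x, x ^ j ∂mboγ) :=
  ⟨(mbo_pow_int i).mul_prod (mbo_pow_int j),
    integral_prod_mul (fun x : ℝ => x ^ i) (fun x : ℝ => x ^ j)⟩

theorem mboHI_const (c : ℝ) : mboHI (fun _ => c) c := ⟨integrable_const _, by simp⟩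

theorem mboHI_odd {F : ℝ × ℝ → ℝ} (hF : Continuous F) (K : ℝ) (n : ℕ)
    (hb : ∀ p, |F p| ≤ K * mboW p ^ n) (ho : ∀ p, F (-p) = - F p) : mboHI F 0 := by
  refine ⟨mbo_intble hF K n hb, ?_⟩
  have m1 : MeasurePreserving (fun x : ℝ => -x) mboγ mboγ :=
    ⟨measurable_neg, by rw [mboγ, gaussianReal_map_neg]; simp⟩
  have m2 : MeasurePreserving (fun p : ℝ × ℝ => -p) mboP mboP := m1.prod m1
  have := m2.integral_comp (MeasurableEquiv.neg (ℝ × ℝ)).measurableEmbedding F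
  simp only [ho, integral_neg] at this
  linarith

theorem mbo_cube (U Q R V h : ℝ) (h0 : 0 ≤ h) (h1 : h ≤ 1) (hU : |U| ≤ V) (hQ : |Q| ≤ V)
    (hR : |R| ≤ V) :
    |(U + h * Q + h ^ 2 * R) ^ 3 - U ^ 3 - 3 * h * (U ^ 2 * Q)| ≤ 23 * h ^ 2 * V ^ 3 := by
  have hV : 0 ≤ V := (abs_nonneg _).trans hU
  set e := Q + h * R with he
  have hee : |e| ≤ 2 * V := by
    refine (abs_add_le _ _).trans ?_
    rw [abs_mul, abs_of_nonneg h0]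
    nlinarith [abs_nonneg R]
  have : (U + h * Q + h ^ 2 * R) ^ 3 - U ^ 3 - 3 * h * (U ^ 2 * Q)
      = h ^ 2 * (3 * U ^ 2 * R + 3 * U * e ^ 2 + h * e ^ 3) := by rw [he]; ring
  rw [this, abs_mul, abs_of_nonneg (by positivity : (0 : ℝ) ≤ h ^ 2)]
  have a1 : |3 * U ^ 2 * R| ≤ 3 * V ^ 3 := by
    rw [abs_mul, abs_mul, abs_pow, abs_of_nonneg (by norm_num : (0 : ℝ) ≤ 3)]
    calc 3 * |U| ^ 2 * |R| ≤ 3 * V ^ 2 * V := by gcongr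
      _ = _ := by ring
  have a2 : |3 * U * e ^ 2| ≤ 12 * V ^ 3 := by
    rw [abs_mul, abs_mul, abs_pow, abs_of_nonneg (by norm_num : (0 : ℝ) ≤ 3)]
    calc 3 * |U| * |e| ^ 2 ≤ 3 * V * (2 * V) ^ 2 := by gcongr
      _ = _ := by ring
  have a3 : |h * e ^ 3| ≤ 8 * V ^ 3 := by
    rw [abs_mul, abs_pow, abs_of_nonneg h0]
    calc h * |e| ^ 3 ≤ 1 * (2 * V) ^ 3 := by gcongr
      _ = _ := by ring
  have a4 := (abs_add_le (3 * U ^ 2 * R + 3 * U * e ^ 2) (h * e ^ 3)).trans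
    (add_le_add ((abs_add_le _ _).trans (add_le_add a1 a2)) a3)
  calc _ ≤ h ^ 2 * (3 * V ^ 3 + 12 * V ^ 3 + 8 * V ^ 3) := by gcongr
    _ = _ := by ring

theorem mbo_core1 (T : ℝ × ℝ → ℝ) (cT : Continuous T) (K C : ℝ) (h z : ℝ) (hh : 0 < h)
    (hh1 : h ≤ 1) (hC : 0 ≤ C) (hTb : ∀ p, |T p| ≤ h ^ 2 * (K * mboW p ^ 5))
    (hA0 : 0 ≤ C + K * mboM 5)
    (hh0 : h < mboG 1 / (C + K * mboM 5 + 1))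
    (hyp : |∫ p, mboΨ ((T p - z) / h) ∂mboP| ≤ C * h ^ 5) :
    |z| ≤ (C + K * mboM 5) / mboG 1 * h ^ 2 := by
  have hg : 0 < mboG 1 := gaussianPDFReal_pos 0 2 1 (by norm_num)
  have cΨ : Continuous (fun p => mboΨ ((T p - z) / h)) := mboΨ_cont.comp (by fun_prop)
  have iΨ : Integrable (fun p => mboΨ ((T p - z) / h)) mboP :=
    mbo_intble cΨ 1 0 fun p => by
      have := mboΨ_bd ((T p - z) / h)
      simp only [pow_zero, mul_one]; linarith
  have s1 : |mboΨ (-z / h)| ≤ (C + K * mboM 5) * h := by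
    have hb := mbo_bound (F := fun p => mboΨ ((T p - z) / h) - mboΨ (-z / h)) (K * h) 5 (by
      intro p
      refine (mboΨ_lip _ _).trans ?_
      rw [← sub_div, abs_div, abs_of_pos hh, div_le_iff₀ hh]
      rw [show T p - z - -z = T p by ring]
      refine (hTb p).trans (le_of_eq (by ring)))
    rw [integral_sub iΨ (integrable_const _)] at hb
    simp only [integral_const, probReal_univ, one_smul] at hb
    have h5 : h ^ 5 ≤ h := by
      have : h ^ 4 ≤ 1 := pow_le_one₀ hh.le hh1
      nlinarith
    have h6 : C * h ^ 5 ≤ C * h := by gcongr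
    rw [abs_le] at hb hyp ⊢
    constructor <;> linarith [hb.1, hb.2, hyp.1, hyp.2]
  generalize C + K * mboM 5 = A at *
  have h1 := (mboΨ_lower (-z / h)).trans s1
  have h2 : A * h < mboG 1 := by
    rw [lt_div_iff₀ (by positivity)] at hh0
    nlinarith
  generalize mboG 1 = g at *
  have h3 : min |-z / h| 1 < 1 := by
    by_contra hcon
    push Not at hcon
    nlinarith
  have h4 : min |-z / h| 1 = |-z / h| := by
    rcases min_choice |-z / h| 1 with h | h
    · exact h
    · rw [h] at h3; exact absurd h3 (lt_irrefl _)
  rw [h4, abs_div, abs_neg, abs_of_pos hh, mul_div_assoc', div_le_iff₀ hh] at h1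
  rw [div_mul_eq_mul_div, le_div_iff₀ hg]
  linarith

theorem mbo_core2 (a : ℝ × ℝ → ℝ) (ca : Continuous a) (L C h : ℝ)
    (hab : ∀ p, |a p| ≤ h * (L * mboW p ^ 5))
    (hyp : |∫ p, mboΨ (a p) ∂mboP| ≤ C * h ^ 5) :
    Integrable (fun p => a p ^ 3) mboP ∧ |∫ p, a p ^ 3 ∂mboP| ≤ h ^ 3 * L ^ 3 * mboM 15 ∧
    |∫ p, a p ∂mboP - (∫ p, a p ^ 3 ∂mboP) / 12| ≤ (C + L ^ 5 * mboM 25) / mboc * h ^ 5 := by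
  have hc := mboc_pos
  have habn : ∀ n p, |a p| ^ n ≤ h ^ n * L ^ n * mboW p ^ (5 * n) := by
    intro n p
    calc |a p| ^ n ≤ (h * (L * mboW p ^ 5)) ^ n := by gcongr; exact hab p
      _ = _ := by rw [pow_mul]; ring
  have ia : Integrable a mboP := mbo_intble ca (h ^ 1 * L ^ 1) 5 fun p => by
    simpa using habn 1 p
  have b3 : ∀ p, |a p ^ 3| ≤ h ^ 3 * L ^ 3 * mboW p ^ 15 := fun p => by
    rw [abs_pow]; exact habn 3 p
  have ia3 : Integrable (fun p => a p ^ 3) mboP := mbo_intble (ca.pow 3) (h ^ 3 * L ^ 3) 15 b3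
  have cΨ : Continuous (fun p => mboΨ (a p)) := mboΨ_cont.comp ca
  have iΨ : Integrable (fun p => mboΨ (a p)) mboP :=
    mbo_intble cΨ 1 0 fun p => by
      have := mboΨ_bd (a p)
      simp only [pow_zero, mul_one]; linarith
  refine ⟨ia3, mbo_bound _ 15 b3, ?_⟩
  have s3 := mbo_bound (F := fun p => mboΨ (a p) - mboc * (a p - a p ^ 3 / 12)) (h ^ 5 * L ^ 5) 25
    (fun p => (mboΨ_taylor (a p)).trans (habn 5 p))
  have i12 : Integrable (fun p => mboc * (a p - a p ^ 3 / 12)) mboP :=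
    (ia.sub (ia3.div_const 12)).const_mul mboc
  rw [integral_sub iΨ i12, integral_const_mul,
    integral_sub ia (ia3.div_const 12), integral_div 12 (fun p => a p ^ 3)] at s3
  generalize (∫ p, a p ∂mboP) - (∫ p, a p ^ 3 ∂mboP) / 12 = X at *
  have h1 : |mboc * X| ≤ (C + L ^ 5 * mboM 25) * h ^ 5 := by
    rw [abs_le] at s3 hyp ⊢
    constructor <;> linarith [s3.1, s3.2, hyp.1, hyp.2]
  rw [abs_mul, abs_of_pos hc] at h1
  rw [div_mul_eq_mul_div, le_div_iff₀ hc]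
  linarith

theorem mbo_core3 (a U Q R : ℝ × ℝ → ℝ) (L h E6 : ℝ) (hh : 0 < h) (hh1 : h ≤ 1)
    (e : ∀ p, a p = h * (U p + h * Q p + h ^ 2 * R p))
    (hUb : ∀ p, |U p| ≤ L * mboW p ^ 5) (hQb : ∀ p, |Q p| ≤ L * mboW p ^ 5)
    (hRb : ∀ p, |R p| ≤ L * mboW p ^ 5)
    (i6 : mboHI (fun p => U p ^ 3) E6) (i7 : mboHI (fun p => U p ^ 2 * Q p) 0)
    (ia3 : Integrable (fun p => a p ^ 3) mboP) :
    |∫ p, a p ^ 3 ∂mboP - h ^ 3 * E6| ≤ 23 * h ^ 5 * L ^ 3 * mboM 15 := by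
  have s8 := mbo_bound (F := fun p => a p ^ 3 - (h ^ 3 * U p ^ 3
      + 3 * h ^ 4 * (U p ^ 2 * Q p))) (23 * h ^ 5 * L ^ 3) 15 (by
    intro p
    have e2 : a p ^ 3 - (h ^ 3 * U p ^ 3 + 3 * h ^ 4 * (U p ^ 2 * Q p))
      = h ^ 3 * ((U p + h * Q p + h ^ 2 * R p) ^ 3 - U p ^ 3
        - 3 * h * (U p ^ 2 * Q p)) := by rw [e]; ring
    rw [e2, abs_mul, abs_of_pos (by positivity : (0 : ℝ) < h ^ 3)]
    have := mbo_cube _ _ _ _ h hh.le hh1 (hUb p) (hQb p) (hRb p)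
    calc _ ≤ h ^ 3 * (23 * h ^ 2 * (L * mboW p ^ 5) ^ 3) := by gcongr
      _ = _ := by ring)
  have i8 := (i6.cmul (h ^ 3)).add (i7.cmul (3 * h ^ 4))
  rw [integral_sub ia3 i8.1, i8.2] at s8
  simpa using s8

theorem mbo_core4 (h z I3 E2 E4 E6 D N L M L' : ℝ) (hh : 0 < h) (hh1 : h ≤ 1) (hD0 : 0 ≤ D)
    (hN : N = |E4| + L ^ 3 * M + D)
    (s4 : |(h ^ 2 * E2 + h ^ 4 * E4 - z) / h - I3 / 12| ≤ D * h ^ 5)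
    (s6 : |I3| ≤ h ^ 3 * L ^ 3 * M) :
    |z - h ^ 2 * E2| ≤ N * h ^ 4 ∧
    (|I3 - h ^ 3 * E6| ≤ 23 * h ^ 5 * L' ^ 3 * M →
      |z - (h ^ 2 * E2 + h ^ 4 * (E4 - E6 / 12))| ≤ (D + 23 * L' ^ 3 * M / 12) * h ^ 6) := by
  have s5 : |h ^ 2 * E2 + h ^ 4 * E4 - z - h * I3 / 12| ≤ D * h ^ 6 := by
    have e : h ^ 2 * E2 + h ^ 4 * E4 - z - h * I3 / 12
      = h * ((h ^ 2 * E2 + h ^ 4 * E4 - z) / h - I3 / 12) := by field_simp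
    rw [e, abs_mul, abs_of_pos hh]
    calc _ ≤ h * (D * h ^ 5) := by gcongr
      _ = _ := by ring
  constructor
  · have h1 : |h ^ 4 * E4| ≤ |E4| * h ^ 4 := by
      rw [abs_mul, abs_of_pos (by positivity : (0 : ℝ) < h ^ 4), mul_comm]
    have h2 : |h * I3 / 12| ≤ L ^ 3 * M * h ^ 4 := by
      rw [abs_div, abs_mul, abs_of_pos hh, abs_of_pos (by norm_num : (0 : ℝ) < 12)]
      have : h * |I3| ≤ h * (h ^ 3 * L ^ 3 * M) := by gcongr
      have : 0 ≤ h * |I3| := by positivity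
      linarith
    have h3 : D * h ^ 6 ≤ D * h ^ 4 := by
      gcongr D * ?_
      exact pow_le_pow_of_le_one hh.le hh1 (by norm_num)
    rw [hN]
    rw [abs_le] at h1 h2 s5 ⊢
    constructor <;> linarith [h1.1, h1.2, h2.1, h2.2, s5.1, s5.2]
  · intro s8
    have s9 : |h * I3 / 12 - h ^ 4 * E6 / 12| ≤ 23 * L' ^ 3 * M / 12 * h ^ 6 := by
      have e : h * I3 / 12 - h ^ 4 * E6 / 12 = h / 12 * (I3 - h ^ 3 * E6) := by ring
      rw [e, abs_mul, abs_of_pos (by positivity : 0 < h / 12)]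
      calc _ ≤ h / 12 * (23 * h ^ 5 * L' ^ 3 * M) := by gcongr
        _ = _ := by ring
    rw [abs_le] at s5 s9 ⊢
    constructor <;> linarith [s5.1, s5.2, s9.1, s9.2]

theorem mbo_core (Q2 Q3 Q4 Q5 : ℝ × ℝ → ℝ) (c2 : Continuous Q2) (c3 : Continuous Q3)
    (c4 : Continuous Q4) (c5 : Continuous Q5) (K : ℝ) (hK : 0 ≤ K)
    (b2 : ∀ p, |Q2 p| ≤ K * mboW p ^ 5) (b3 : ∀ p, |Q3 p| ≤ K * mboW p ^ 5)
    (b4 : ∀ p, |Q4 p| ≤ K * mboW p ^ 5) (b5 : ∀ p, |Q5 p| ≤ K * mboW p ^ 5)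
    (E2 E4 E6 : ℝ) (i2 : mboHI Q2 E2) (i3 : mboHI Q3 0) (i4 : mboHI Q4 E4) (i5 : mboHI Q5 0)
    (i6 : mboHI (fun p => (Q2 p - E2) ^ 3) E6)
    (i7 : mboHI (fun p => (Q2 p - E2) ^ 2 * Q3 p) 0) (C : ℝ) (hC : 0 ≤ C) :
    ∃ C' h0 : ℝ, 0 < h0 ∧ ∀ h z : ℝ, 0 < h → h < h0 → h ≤ 1 →
      |∫ p, mboΨ ((h ^ 2 * Q2 p + h ^ 3 * Q3 p + h ^ 4 * Q4 p + h ^ 5 * Q5 p - z) / h) ∂mboP|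
        ≤ C * h ^ 5 →
      |z - (h ^ 2 * E2 + h ^ 4 * (E4 - E6 / 12))| ≤ C' * h ^ 6 := by
  have hg : 0 < mboG 1 := gaussianPDFReal_pos 0 2 1 (by norm_num)
  have hc := mboc_pos
  have hW0 : ∀ p, 0 < mboW p := fun p => zero_lt_one.trans_le (mboW_ge p)
  have hW1 : ∀ p, 1 ≤ mboW p ^ 5 := fun p => one_le_pow₀ (mboW_ge p)
  have hV : ∀ p, 0 ≤ mboW p ^ 5 := fun p => (zero_le_one.trans (hW1 p))
  have hA0 : 0 ≤ C + 4 * K * mboM 5 := by have := mboM_nonneg 5; positivity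
  obtain ⟨B, hB⟩ : ∃ B, B = (C + 4 * K * mboM 5) / mboG 1 := ⟨_, rfl⟩
  have hB0 : 0 ≤ B := by rw [hB]; positivity
  obtain ⟨L, hL⟩ : ∃ L, L = 4 * K + B := ⟨_, rfl⟩
  have hL0 : 0 ≤ L := by rw [hL]; positivity
  obtain ⟨D, hD⟩ : ∃ D, D = (C + L ^ 5 * mboM 25) / mboc := ⟨_, rfl⟩
  have hD0 : 0 ≤ D := by have := mboM_nonneg 25; rw [hD]; positivity
  obtain ⟨N, hN⟩ : ∃ N, N = |E4| + L ^ 3 * mboM 15 + D := ⟨_, rfl⟩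
  have hN0 : 0 ≤ N := by have := mboM_nonneg 15; rw [hN]; positivity
  obtain ⟨L', hL'⟩ : ∃ L', L' = 2 * K + N + |E2| := ⟨_, rfl⟩
  have hL'K : K ≤ L' := by rw [hL']; linarith [abs_nonneg E2]
  refine ⟨D + 23 * L' ^ 3 * mboM 15 / 12, mboG 1 / (C + 4 * K * mboM 5 + 1), by positivity, ?_⟩
  intro h z hh hh0 hh1 hyp
  obtain ⟨T, hT⟩ : ∃ T : ℝ × ℝ → ℝ,
    T = fun p => h ^ 2 * Q2 p + h ^ 3 * Q3 p + h ^ 4 * Q4 p + h ^ 5 * Q5 p := ⟨_, rfl⟩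
  have hTp : ∀ p, h ^ 2 * Q2 p + h ^ 3 * Q3 p + h ^ 4 * Q4 p + h ^ 5 * Q5 p = T p := fun p => by
    rw [hT]
  simp only [hTp] at hyp
  have cT : Continuous T := by rw [hT]; fun_prop
  have g : ∀ (n : ℕ) (p : ℝ × ℝ) (q : ℝ), |q| ≤ K * mboW p ^ 5 → |h ^ n * q| ≤ K * mboW p ^ 5 := by
    intro n p q hq
    rw [abs_mul, abs_of_pos (by positivity : (0 : ℝ) < h ^ n)]
    have : h ^ n ≤ 1 := pow_le_one₀ hh.le hh1
    exact (mul_le_of_le_one_left (abs_nonneg q) this).trans hq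
  have hTb : ∀ p, |T p| ≤ h ^ 2 * (4 * K * mboW p ^ 5) := by
    intro p
    have e : T p = h ^ 2 * (Q2 p + h ^ 1 * Q3 p + h ^ 2 * Q4 p + h ^ 3 * Q5 p) := by rw [hT]; ring
    rw [e, abs_mul, abs_of_pos (by positivity : (0 : ℝ) < h ^ 2)]
    gcongr
    have := (abs_add_le (Q2 p + h ^ 1 * Q3 p + h ^ 2 * Q4 p) (h ^ 3 * Q5 p)).trans (add_le_add
      ((abs_add_le _ _).trans (add_le_add ((abs_add_le _ _).trans (add_le_add (b2 p) (g 1 p _ (b3 p))))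
        (g 2 p _ (b4 p)))) (g 3 p _ (b5 p)))
    linarith
  have s2 := mbo_core1 T cT (4 * K) C h z hh hh1 hC hTb hA0 hh0 hyp
  rw [← hB] at s2
  obtain ⟨a, ha⟩ : ∃ a : ℝ × ℝ → ℝ, ∀ p, a p = (T p - z) / h := ⟨fun p => (T p - z) / h, fun p => rfl⟩
  simp only [← ha] at hyp
  have ca : Continuous a := by rw [show a = fun p => (T p - z) / h from funext ha]; fun_prop
  have hab : ∀ p, |a p| ≤ h * (L * mboW p ^ 5) := by
    intro p
    rw [ha, abs_div, abs_of_pos hh, div_le_iff₀ hh]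
    refine (abs_sub _ _).trans ?_
    have h1 := hTb p
    have h2 : B * h ^ 2 ≤ B * h ^ 2 * mboW p ^ 5 := le_mul_of_one_le_right (by positivity) (hW1 p)
    rw [hL]
    calc _ ≤ h ^ 2 * (4 * K * mboW p ^ 5) + B * h ^ 2 * mboW p ^ 5 := by linarith
      _ = _ := by ring
  obtain ⟨ia3, s6, s4⟩ := mbo_core2 a ca L C h hab hyp
  rw [← hD] at s4
  have ea : ∫ p, a p ∂mboP = (h ^ 2 * E2 + h ^ 4 * E4 - z) / h := by
    have := (((((i2.cmul (h ^ 2)).add (i3.cmul (h ^ 3))).add (i4.cmul (h ^ 4))).add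
      (i5.cmul (h ^ 5))).add (mboHI_const (-z))).cmul h⁻¹
    have h2 := this.2
    rw [show h⁻¹ * (h ^ 2 * E2 + h ^ 3 * 0 + h ^ 4 * E4 + h ^ 5 * 0 + -z)
      = (h ^ 2 * E2 + h ^ 4 * E4 - z) / h by rw [div_eq_inv_mul]; ring] at h2
    rw [← h2]
    congr 1; ext p
    beta_reduce
    rw [ha, hTp, div_eq_inv_mul]; ring
  rw [ea] at s4
  obtain ⟨s7, fin⟩ := mbo_core4 h z _ E2 E4 E6 D N L (mboM 15) L' hh hh1 hD0 hN s4 s6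
  apply fin
  refine mbo_core3 a (fun p => Q2 p - E2) Q3 (fun p => Q4 p + h ^ 1 * Q5 p - (z - h ^ 2 * E2) / h ^ 4)
    L' h E6 hh hh1 ?_ ?_ ?_ ?_ i6 i7 ia3
  · intro p
    rw [ha, hT]
    field_simp
    ring
  · intro p
    refine (abs_sub _ _).trans ?_
    have h1 : |E2| ≤ |E2| * mboW p ^ 5 := le_mul_of_one_le_right (abs_nonneg _) (hW1 p)
    have h2 := mul_nonneg (add_nonneg hK hN0) (hV p)
    rw [hL']
    linarith [b2 p]
  · intro p
    exact (b3 p).trans (mul_le_mul_of_nonneg_right hL'K (hV p))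
  · intro p
    have h1 : |(z - h ^ 2 * E2) / h ^ 4| ≤ N := by
      rw [abs_div, abs_of_pos (by positivity : (0 : ℝ) < h ^ 4), div_le_iff₀ (by positivity)]
      exact s7
    have h3 := (abs_sub (Q4 p + h ^ 1 * Q5 p) ((z - h ^ 2 * E2) / h ^ 4)).trans
      (add_le_add ((abs_add_le _ _).trans (add_le_add (b4 p) (g 1 p _ (b5 p)))) h1)
    refine h3.trans ?_
    have h4 : N ≤ N * mboW p ^ 5 := le_mul_of_one_le_right hN0 (hW1 p)
    have h5 := mul_nonneg (abs_nonneg E2) (hV p)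
    rw [hL']
    linarith

open MeasureTheory ProbabilityTheory Set

theorem mbo_mono_bd (i j n : ℕ) (hn : i + j ≤ n) (p : ℝ × ℝ) : |p.1 ^ i * p.2 ^ j| ≤ mboW p ^ n := by
  have h0 : 0 ≤ mboW p := zero_le_one.trans (mboW_ge p)
  rw [abs_mul, abs_pow, abs_pow]
  calc |p.1| ^ i * |p.2| ^ j ≤ mboW p ^ i * mboW p ^ j := by
        gcongr
        · exact mboW_x p
        · exact mboW_y p
    _ = mboW p ^ (i + j) := (pow_add _ _ _).symm
    _ ≤ _ := pow_le_pow_right₀ (mboW_ge p) hn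

def mboBd (n : ℕ) (F : ℝ × ℝ → ℝ) : Prop := ∃ K, 0 ≤ K ∧ ∀ p, |F p| ≤ K * mboW p ^ n

theorem mboBd.add {n : ℕ} {F G : ℝ × ℝ → ℝ} (hF : mboBd n F) (hG : mboBd n G) :
    mboBd n (fun p => F p + G p) := by
  obtain ⟨K, hK, h⟩ := hF
  obtain ⟨K', hK', h'⟩ := hG
  refine ⟨K + K', by positivity, fun p => (abs_add_le _ _).trans ?_⟩
  rw [add_mul]; exact add_le_add (h p) (h' p)

theorem mboBd.mul {n m : ℕ} {F G : ℝ × ℝ → ℝ} (hF : mboBd n F) (hG : mboBd m G) :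
    mboBd (n + m) (fun p => F p * G p) := by
  obtain ⟨K, hK, h⟩ := hF
  obtain ⟨K', hK', h'⟩ := hG
  refine ⟨K * K', by positivity, fun p => ?_⟩
  have h0 : 0 ≤ mboW p := zero_le_one.trans (mboW_ge p)
  rw [abs_mul, pow_add]
  calc _ ≤ (K * mboW p ^ n) * (K' * mboW p ^ m) := by
        gcongr
        · exact h p
        · exact h' p
    _ = _ := by ring

theorem mboBd_mono (c : ℝ) (i j n : ℕ) (hn : i + j ≤ n) :
    mboBd n (fun p => c * (p.1 ^ i * p.2 ^ j)) := by
  refine ⟨|c|, abs_nonneg c, fun p => ?_⟩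
  rw [abs_mul]
  gcongr
  exact mbo_mono_bd i j n hn p

/-- the scaled Taylor approximation in terms of the Gaussian average -/
theorem mbo_approx {f : ℝ → ℝ → ℝ} (hf : mboSm f) (Tay : ℝ → ℝ → ℝ)
    (cTay : Continuous (fun p : ℝ × ℝ => Tay p.1 p.2)) (C : ℝ) (hC : 0 ≤ C)
    (hT : ∀ x y, |x| ≤ 1 → |y| ≤ 1 → |f x y - Tay x y| ≤ C * (|x| + |y|) ^ 6)
    (h z : ℝ) (hh : 0 < h) (hh1 : h ≤ 1)
    (h0 : ∫ p : ℝ × ℝ, mboΨ ((f (h * p.1) (h * p.2) - z) / h) ∂mboP = 0) :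
    |∫ p : ℝ × ℝ, mboΨ ((Tay (h * p.1) (h * p.2) - z) / h) ∂mboP| ≤ (C + 1) * mboM 6 * h ^ 5 := by
  have hi : ∀ g : ℝ → ℝ → ℝ, Continuous (fun p : ℝ × ℝ => g p.1 p.2) →
      Integrable (fun p : ℝ × ℝ => mboΨ ((g (h * p.1) (h * p.2) - z) / h)) mboP := by
    intro g hg
    have hcont : Continuous (fun p : ℝ × ℝ => mboΨ ((g (h * p.1) (h * p.2) - z) / h)) := by
      apply mboΨ_cont.comp
      have : Continuous (fun p : ℝ × ℝ => g (h * p.1) (h * p.2)) :=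
        hg.comp (f := fun p : ℝ × ℝ => (h * p.1, h * p.2)) (by fun_prop)
      fun_prop
    exact mbo_intble hcont 1 0 fun p => by
      have := mboΨ_bd ((g (h * p.1) (h * p.2) - z) / h)
      simp only [pow_zero, mul_one]; linarith
  have hb := mbo_bound (F := fun p : ℝ × ℝ => mboΨ ((Tay (h * p.1) (h * p.2) - z) / h)
      - mboΨ ((f (h * p.1) (h * p.2) - z) / h)) ((C + 1) * h ^ 5) 6 (by
    intro p
    have hW := mboW_ge p
    have hh5 : 0 < h ^ 5 := by positivity
    by_cases hp : |h * p.1| ≤ 1 ∧ |h * p.2| ≤ 1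
    · refine (mboΨ_lip _ _).trans ?_
      rw [← sub_div, abs_div, abs_of_pos hh, div_le_iff₀ hh]
      rw [show Tay (h * p.1) (h * p.2) - z - (f (h * p.1) (h * p.2) - z)
        = -(f (h * p.1) (h * p.2) - Tay (h * p.1) (h * p.2)) by ring, abs_neg]
      refine (hT _ _ hp.1 hp.2).trans ?_
      rw [abs_mul, abs_mul, abs_of_pos hh, ← mul_add, mul_pow]
      have h1 : (|p.1| + |p.2|) ^ 6 ≤ mboW p ^ 6 := by
        gcongr
        unfold mboW; linarith
      calc C * (h ^ 6 * (|p.1| + |p.2|) ^ 6) ≤ (C + 1) * (h ^ 6 * mboW p ^ 6) := by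
            gcongr; linarith
        _ = _ := by ring
    · have h1 : 1 ≤ h * mboW p := by
        rw [not_and_or, not_le, not_le, abs_mul, abs_mul, abs_of_pos hh] at hp
        rcases hp with hp | hp
        · exact hp.le.trans (by gcongr; exact mboW_x p)
        · exact hp.le.trans (by gcongr; exact mboW_y p)
      have h2 : 1 ≤ (h * mboW p) ^ 6 := one_le_pow₀ h1
      refine (abs_sub _ _).trans ?_
      have e1 := mboΨ_bd ((Tay (h * p.1) (h * p.2) - z) / h)
      have e2 := mboΨ_bd ((f (h * p.1) (h * p.2) - z) / h)
      have h3 : (h * mboW p) ^ 6 ≤ h ^ 5 * mboW p ^ 6 := by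
        rw [mul_pow]
        gcongr ?_ * _
        exact pow_le_pow_of_le_one hh.le hh1 (by norm_num)
      have h4 : 0 ≤ C * (h ^ 5 * mboW p ^ 6) := by positivity
      linarith)
  rw [integral_sub (hi Tay cTay) (hi f hf.continuous), h0, sub_zero] at hb
  refine hb.trans (le_of_eq (by ring))

theorem mbo_E6 (a b c : ℝ) : mboHI (fun p => (a / 2 * (p.1 ^ 2 * p.2 ^ 0) + b * (p.1 ^ 1 * p.2 ^ 1)
      + c / 2 * (p.1 ^ 0 * p.2 ^ 2) - (a + c)) ^ 3)
    (8 * (a ^ 3 + 3 * a * b ^ 2 + 3 * c * b ^ 2 + c ^ 3)) := by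
  have q3 := (((((((mboHI_mono 6 0).cmul ((a/2)^3)).add
    ((mboHI_mono 5 1).cmul (3*(a/2)^2*b))).add
    ((mboHI_mono 4 2).cmul (3*(a/2)^2*(c/2) + 3*(a/2)*b^2))).add
    ((mboHI_mono 3 3).cmul (b^3+6*(a/2)*b*(c/2)))).add
    ((mboHI_mono 2 4).cmul (3*(a/2)*(c/2)^2+3*b^2*(c/2)))).add
    ((mboHI_mono 1 5).cmul (3*b*(c/2)^2))).add
    ((mboHI_mono 0 6).cmul ((c/2)^3))
  have q2 := (((((mboHI_mono 4 0).cmul ((a/2)^2)).add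
    ((mboHI_mono 3 1).cmul (2*(a/2)*b))).add
    ((mboHI_mono 2 2).cmul (b^2+2*(a/2)*(c/2)))).add
    ((mboHI_mono 1 3).cmul (2*b*(c/2)))).add
    ((mboHI_mono 0 4).cmul ((c/2)^2))
  have q1 := (((mboHI_mono 2 0).cmul (a/2)).add
    ((mboHI_mono 1 1).cmul b)).add
    ((mboHI_mono 0 2).cmul (c/2))
  have := ((q3.add (q2.cmul (-3*(a+c)))).add (q1.cmul (3*(a+c)^2))).add (mboHI_const (-(a+c)^3))
  simp only [mbo_m0, mbo_m1, mbo_m2, mbo_m3, mbo_m4, mbo_m5, mbo_m6] at this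
  convert this using 1
  · ext p; ring
  · ring

theorem mbo_final {f : ℝ → ℝ → ℝ} (hf : mboSm f)
    (h0 : f 0 0 = 0) (hfx : pdx f 0 0 = 0) (hfy : pdy f 0 0 = 0) :
    ∃ C' h0 : ℝ, 0 < h0 ∧ ∀ h z : ℝ, 0 < h → h < h0 → h ≤ 1 →
      ∫ p : ℝ × ℝ, mboΨ ((f (h * p.1) (h * p.2) - z) / h) ∂mboP = 0 →
      |z - (h ^ 2 * (mboD f 2 0 0 0 + mboD f 0 2 0 0)
        + h ^ 4 * ((1 / 2) * (mboD f 4 0 0 0 + 2 * mboD f 2 2 0 0 + mboD f 0 4 0 0)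
          - (2 / 3) * (mboD f 2 0 0 0 ^ 3 + 3 * mboD f 2 0 0 0 * mboD f 1 1 0 0 ^ 2
            + 3 * mboD f 0 2 0 0 * mboD f 1 1 0 0 ^ 2 + mboD f 0 2 0 0 ^ 3)))| ≤ C' * h ^ 6 := by
  obtain ⟨C, hC, hTay⟩ := mbo_taylor2 hf
  have d00 : mboD f 0 0 0 0 = 0 := h0
  have d10 : mboD f 1 0 0 0 = 0 := hfx
  have d01 : mboD f 0 1 0 0 = 0 := hfy
  generalize mboD f = d at *
  obtain ⟨Q2, hQ2⟩ : ∃ Q : ℝ × ℝ → ℝ, Q = fun p => d 2 0 0 0 / 2 * (p.1 ^ 2 * p.2 ^ 0)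
    + d 1 1 0 0 * (p.1 ^ 1 * p.2 ^ 1) + d 0 2 0 0 / 2 * (p.1 ^ 0 * p.2 ^ 2) := ⟨_, rfl⟩
  obtain ⟨Q3, hQ3⟩ : ∃ Q : ℝ × ℝ → ℝ, Q = fun p => d 3 0 0 0 / 6 * (p.1 ^ 3 * p.2 ^ 0)
    + d 2 1 0 0 / 2 * (p.1 ^ 2 * p.2 ^ 1) + d 1 2 0 0 / 2 * (p.1 ^ 1 * p.2 ^ 2)
    + d 0 3 0 0 / 6 * (p.1 ^ 0 * p.2 ^ 3) := ⟨_, rfl⟩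
  obtain ⟨Q4, hQ4⟩ : ∃ Q : ℝ × ℝ → ℝ, Q = fun p => d 4 0 0 0 / 24 * (p.1 ^ 4 * p.2 ^ 0)
    + d 3 1 0 0 / 6 * (p.1 ^ 3 * p.2 ^ 1) + d 2 2 0 0 / 4 * (p.1 ^ 2 * p.2 ^ 2)
    + d 1 3 0 0 / 6 * (p.1 ^ 1 * p.2 ^ 3) + d 0 4 0 0 / 24 * (p.1 ^ 0 * p.2 ^ 4) := ⟨_, rfl⟩
  obtain ⟨Q5, hQ5⟩ : ∃ Q : ℝ × ℝ → ℝ, Q = fun p => d 5 0 0 0 / 120 * (p.1 ^ 5 * p.2 ^ 0)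
    + d 4 1 0 0 / 24 * (p.1 ^ 4 * p.2 ^ 1) + d 3 2 0 0 / 12 * (p.1 ^ 3 * p.2 ^ 2)
    + d 2 3 0 0 / 12 * (p.1 ^ 2 * p.2 ^ 3) + d 1 4 0 0 / 24 * (p.1 ^ 1 * p.2 ^ 4)
    + d 0 5 0 0 / 120 * (p.1 ^ 0 * p.2 ^ 5) := ⟨_, rfl⟩
  obtain ⟨Tay, hTdef⟩ : ∃ Tay : ℝ → ℝ → ℝ, Tay = fun x y =>
    Q2 (x, y) + Q3 (x, y) + Q4 (x, y) + Q5 (x, y) := ⟨_, rfl⟩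
  have c2 : Continuous Q2 := by rw [hQ2]; fun_prop
  have c3 : Continuous Q3 := by rw [hQ3]; fun_prop
  have c4 : Continuous Q4 := by rw [hQ4]; fun_prop
  have c5 : Continuous Q5 := by rw [hQ5]; fun_prop
  have B2 : mboBd 5 Q2 := by
    rw [hQ2]
    exact ((mboBd_mono _ 2 0 5 (by norm_num)).add (mboBd_mono _ 1 1 5 (by norm_num))).add
      (mboBd_mono _ 0 2 5 (by norm_num))
  have B3 : mboBd 5 Q3 := by
    rw [hQ3]
    exact (((mboBd_mono _ 3 0 5 (by norm_num)).add (mboBd_mono _ 2 1 5 (by norm_num))).add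
      (mboBd_mono _ 1 2 5 (by norm_num))).add (mboBd_mono _ 0 3 5 (by norm_num))
  have B4 : mboBd 5 Q4 := by
    rw [hQ4]
    exact ((((mboBd_mono _ 4 0 5 (by norm_num)).add (mboBd_mono _ 3 1 5 (by norm_num))).add
      (mboBd_mono _ 2 2 5 (by norm_num))).add (mboBd_mono _ 1 3 5 (by norm_num))).add
      (mboBd_mono _ 0 4 5 (by norm_num))
  have B5 : mboBd 5 Q5 := by
    rw [hQ5]
    exact (((((mboBd_mono _ 5 0 5 (by norm_num)).add (mboBd_mono _ 4 1 5 (by norm_num))).add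
      (mboBd_mono _ 3 2 5 (by norm_num))).add (mboBd_mono _ 2 3 5 (by norm_num))).add
      (mboBd_mono _ 1 4 5 (by norm_num))).add (mboBd_mono _ 0 5 5 (by norm_num))
  have B7 : mboBd (5 + 5 + 5)
      (fun p => (Q2 p + -(d 2 0 0 0 + d 0 2 0 0) * (p.1 ^ 0 * p.2 ^ 0))
        * (Q2 p + -(d 2 0 0 0 + d 0 2 0 0) * (p.1 ^ 0 * p.2 ^ 0)) * Q3 p) :=
    ((B2.add (mboBd_mono _ 0 0 5 (by norm_num))).mul
      (B2.add (mboBd_mono _ 0 0 5 (by norm_num)))).mul B3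
  obtain ⟨K2, k2, b2⟩ := B2
  obtain ⟨K3, k3, b3⟩ := B3
  obtain ⟨K4, k4, b4⟩ := B4
  obtain ⟨K5, k5, b5⟩ := B5
  obtain ⟨K7, k7, b7⟩ := B7
  have o3 : ∀ p, Q3 (-p) = - Q3 p := by
    intro p; rw [hQ3]; simp only [Prod.fst_neg, Prod.snd_neg]; ring
  have o2 : ∀ p, Q2 (-p) = Q2 p := by
    intro p; rw [hQ2]; simp only [Prod.fst_neg, Prod.snd_neg]; ring
  have o5 : ∀ p, Q5 (-p) = - Q5 p := by
    intro p; rw [hQ5]; simp only [Prod.fst_neg, Prod.snd_neg]; ring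
  have i2 : mboHI Q2 (d 2 0 0 0 + d 0 2 0 0) := by
    have := (((mboHI_mono 2 0).cmul (d 2 0 0 0 / 2)).add
      ((mboHI_mono 1 1).cmul (d 1 1 0 0))).add ((mboHI_mono 0 2).cmul (d 0 2 0 0 / 2))
    simp only [mbo_m0, mbo_m1, mbo_m2] at this
    rw [hQ2]
    convert this using 1
    ring
  have i4 : mboHI Q4 ((1 / 2) * (d 4 0 0 0 + 2 * d 2 2 0 0 + d 0 4 0 0)) := by
    have := (((((mboHI_mono 4 0).cmul (d 4 0 0 0 / 24)).add
      ((mboHI_mono 3 1).cmul (d 3 1 0 0 / 6))).add ((mboHI_mono 2 2).cmul (d 2 2 0 0 / 4))).add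
      ((mboHI_mono 1 3).cmul (d 1 3 0 0 / 6))).add ((mboHI_mono 0 4).cmul (d 0 4 0 0 / 24))
    simp only [mbo_m0, mbo_m1, mbo_m2, mbo_m3, mbo_m4] at this
    rw [hQ4]
    convert this using 1
    ring
  have i3 : mboHI Q3 0 := mboHI_odd c3 K3 5 b3 o3
  have i5 : mboHI Q5 0 := mboHI_odd c5 K5 5 b5 o5
  have i6 := mbo_E6 (d 2 0 0 0) (d 1 1 0 0) (d 0 2 0 0)
  have i6' : mboHI (fun p => (Q2 p - (d 2 0 0 0 + d 0 2 0 0)) ^ 3)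
      (8 * (d 2 0 0 0 ^ 3 + 3 * d 2 0 0 0 * d 1 1 0 0 ^ 2
        + 3 * d 0 2 0 0 * d 1 1 0 0 ^ 2 + d 0 2 0 0 ^ 3)) := by
    rw [hQ2]; exact i6
  have i7 : mboHI (fun p => (Q2 p - (d 2 0 0 0 + d 0 2 0 0)) ^ 2 * Q3 p) 0 := by
    refine mboHI_odd (by fun_prop) K7 (5 + 5 + 5) (fun p => ?_) (fun p => ?_)
    · refine le_trans (le_of_eq ?_) (b7 p)
      congr 1; ring
    · rw [o2, o3]; ring
  have hW : ∀ p, 0 ≤ mboW p ^ 5 := fun p => pow_nonneg (zero_le_one.trans (mboW_ge p)) 5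
  obtain ⟨C', h0', hpos, hmain⟩ := mbo_core Q2 Q3 Q4 Q5 c2 c3 c4 c5 (K2 + K3 + K4 + K5)
    (by positivity)
    (fun p => (b2 p).trans (mul_le_mul_of_nonneg_right (by linarith) (hW p)))
    (fun p => (b3 p).trans (mul_le_mul_of_nonneg_right (by linarith) (hW p)))
    (fun p => (b4 p).trans (mul_le_mul_of_nonneg_right (by linarith) (hW p)))
    (fun p => (b5 p).trans (mul_le_mul_of_nonneg_right (by linarith) (hW p)))
    _ _ _ i2 i3 i4 i5 i6' i7 ((C + 1) * mboM 6)
    (by have := mboM_nonneg 6; positivity)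
  refine ⟨C', h0', hpos, ?_⟩
  intro h z hh hh0 hh1 hz
  have hTay' : ∀ x y, |x| ≤ 1 → |y| ≤ 1 → |f x y - Tay x y| ≤ C * (|x| + |y|) ^ 6 := by
    intro x y hx hy
    refine le_trans (le_of_eq ?_) (hTay x y hx hy)
    congr 2
    rw [hTdef, hQ2, hQ3, hQ4, hQ5]
    simp [Finset.sum_range_succ, Nat.factorial, d00, d10, d01]
    ring
  have cTay : Continuous (fun p : ℝ × ℝ => Tay p.1 p.2) := by
    rw [hTdef]; fun_prop
  have hap := mbo_approx hf Tay cTay C hC hTay' h z hh hh1 hz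
  have e : ∀ p : ℝ × ℝ, Tay (h * p.1) (h * p.2)
      = h ^ 2 * Q2 p + h ^ 3 * Q3 p + h ^ 4 * Q4 p + h ^ 5 * Q5 p := by
    intro p
    rw [hTdef, hQ2, hQ3, hQ4, hQ5]
    ring
  simp only [e] at hap
  have := hmain h z hh hh0 hh1 hap
  refine le_trans (le_of_eq ?_) this
  congr 1
  ring

theorem mbo_one_step_consistency (f : ℝ → ℝ → ℝ)
    (hf : ContDiff ℝ (⊤ : ℕ∞) (fun p : ℝ × ℝ => f p.1 p.2))
    (h0 : f 0 0 = 0) (hfx : pdx f 0 0 = 0) (hfy : pdy f 0 0 = 0)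
    (S : Set (ℝ × ℝ × ℝ)) (hS : S = {p : ℝ × ℝ × ℝ | p.2.2 ≤ f p.1 p.2.1})
    (ε : ℝ) (hε : 0 < ε) (z : ℝ → ℝ)
    (hz0 : Filter.Tendsto z (nhdsWithin 0 (Set.Ioi 0)) (nhds 0))
    (hzeq : ∀ t ∈ Set.Ioo (0 : ℝ) ε, conv3 t (Set.indicator S 1) (0, 0, z t) = 1 / 2) :
    let fxx := pdx (pdx f) 0 0
    let fyy := pdy (pdy f) 0 0
    let fxy := pdx (fun a b => pdy f a b) 0 0
    let fxxxx := pdx (pdx (pdx (pdx f))) 0 0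
    let fxxyy := pdx (pdx (pdy (pdy f))) 0 0
    let fyyyy := pdy (pdy (pdy (pdy f))) 0 0
    ∃ C ε' : ℝ, 0 < ε' ∧ ∀ t ∈ Set.Ioo (0 : ℝ) ε',
      |z t - (t * (fxx + fyy)
        + t ^ 2 * ((1 / 2) * (fxxxx + 2 * fxxyy + fyyyy)
          - (2 / 3) * (fxx ^ 3 + 3 * fxx * fxy ^ 2 + 3 * fyy * fxy ^ 2 + fyy ^ 3)))|
        ≤ C * t ^ 3 := by
  obtain ⟨C', r, hr, hmain⟩ := mbo_final (f := f) hf h0 hfx hfy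
  refine ⟨C', min ε (min (r ^ 2) 1), by positivity, ?_⟩
  rintro t ⟨ht0, ht⟩
  have ht1 : t < ε := ht.trans_le (min_le_left _ _)
  have ht2 : t < r ^ 2 := ht.trans_le ((min_le_right _ _).trans (min_le_left _ _))
  have ht3 : t < 1 := ht.trans_le ((min_le_right _ _).trans (min_le_right _ _))
  obtain ⟨h, hh, rfl⟩ : ∃ h : ℝ, 0 < h ∧ t = h ^ 2 :=
    ⟨√t, Real.sqrt_pos.2 ht0, (Real.sq_sqrt ht0.le).symm⟩
  have hhr : h < r := lt_of_pow_lt_pow_left₀ 2 hr.le ht2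
  have hh1 : h ≤ 1 := by nlinarith
  have hz := hzeq (h ^ 2) ⟨ht0, ht1⟩
  rw [hS, mbo_conv f hf.continuous h hh] at hz
  have := hmain h (z (h ^ 2)) hh hhr hh1 (by linarith)
  rw [← pow_mul, ← pow_mul]
  exact this
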